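/- For any state ρ on a bipartite system and any state σ on the same system whose partial transpose σ^Γ is positive semidefinite and whose support contains the support of ρ, the p.p.t. distillable entanglement satisfies D_Γ(ρ) ≤ S(ρ||σ). -/

import Mathlib

open Matrix Filter
open scoped ComplexOrder

noncomputable section

/-- Partial transpose on the second tensor factor:
`ptrans M ((i,j),(k,l)) = M ((i,l),(k,j))`. -/
def ptrans {ι κ : Type*} (M : Matrix (ι × κ) (ι × κ) ℂ) : Matrix (ι × κ) (ι × κ) ℂ :=
  fun x y => M (x.1, y.2) (y.1, x.2)

/-- Fidelity of `K`-state p.p.t. distillation: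
the supremum of `Tr(Fρ)` over Hermitian `F` with `0 ≤ F ≤ 1` and `-1/K ≤ F^Γ ≤ 1/K`. -/
def FGamma {ι κ : Type*} [Fintype ι] [Fintype κ] [DecidableEq ι] [DecidableEq κ]
    (ρ : Matrix (ι × κ) (ι × κ) ℂ) (K : ℝ) : ℝ :=
  sSup {x : ℝ | ∃ F : Matrix (ι × κ) (ι × κ) ℂ,
    F.PosSemidef ∧ (1 - F).PosSemidef ∧
    (((1 / K : ℝ) : ℂ) • 1 - ptrans F).PosSemidef ∧
    (ptrans F + ((1 / K : ℝ) : ℂ) • 1).PosSemidef ∧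
    x = ((F * ρ).trace).re}

/-- `n`-fold tensor power of a bipartite matrix, regrouped as a bipartite matrix. -/
def tpow {ι κ : Type*} (ρ : Matrix (ι × κ) (ι × κ) ℂ) (n : ℕ) :
    Matrix ((Fin n → ι) × (Fin n → κ)) ((Fin n → ι) × (Fin n → κ)) ℂ :=
  fun x y => ∏ i, ρ (x.1 i, x.2 i) (y.1 i, y.2 i)

/-- p.p.t. distillable entanglement. -/
def DGamma {ι κ : Type*} [Fintype ι] [Fintype κ] [DecidableEq ι] [DecidableEq κ]
    (ρ : Matrix (ι × κ) (ι × κ) ℂ) : ℝ :=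
  sSup {r : ℝ | 0 ≤ r ∧
    Tendsto (fun n : ℕ => FGamma (tpow ρ n) ((⌊(2 : ℝ) ^ (r * (n : ℝ))⌋ : ℤ) : ℝ))
      atTop (nhds 1)}

/-- Base-2 logarithm of a Hermitian matrix via the spectral theorem
(with the convention `log 0 = 0` on the kernel, and junk value `0` otherwise). -/
def hermLog2 {n : Type*} [Fintype n] [DecidableEq n] (A : Matrix n n ℂ) : Matrix n n ℂ :=
  if h : A.IsHermitian then
    (h.eigenvectorUnitary : Matrix n n ℂ) *
      Matrix.diagonal (fun i => ((Real.logb 2 (h.eigenvalues i) : ℝ) : ℂ)) *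
      star (h.eigenvectorUnitary : Matrix n n ℂ)
  else 0

/-- Relative entropy `S(ρ‖σ) = Tr(ρ (log₂ ρ - log₂ σ))`. -/
def relEnt {n : Type*} [Fintype n] [DecidableEq n] (ρ σ : Matrix n n ℂ) : ℝ :=
  ((ρ * (hermLog2 ρ - hermLog2 σ)).trace).re

/-- Entrywise tensor power of a matrix, indexed by functions. -/
def piPow {m k : Type*} (A : Matrix m k ℂ) (n : ℕ) : Matrix (Fin n → m) (Fin n → k) ℂ :=
  fun x y => ∏ i, A (x i) (y i)

lemma sum_prod_comp {R m : Type*} [CommSemiring R] [Fintype m] (f : m → R) (n : ℕ) :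
    ∑ x : Fin n → m, ∏ i, f (x i) = (∑ a, f a) ^ n := by
  classical
  rw [Finset.sum_pow']
  simp

lemma sum_sum_prod_comp {R m k : Type*} [CommSemiring R] [Fintype m] [Fintype k]
    (f : m → k → R) (n : ℕ) :
    ∑ x : Fin n → m, ∑ y : Fin n → k, ∏ i, f (x i) (y i) = (∑ a, ∑ b, f a b) ^ n := by
  classical
  rw [← sum_prod_comp]
  refine Finset.sum_congr rfl fun x _ => ?_
  rw [Finset.prod_univ_sum]
  simp

section piPow

variable {m k l : Type*}

lemma piPow_mul [Fintype k] (A : Matrix m k ℂ) (B : Matrix k l ℂ) (n : ℕ) :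
    piPow (A * B) n = piPow A n * piPow B n := by
  classical
  ext x y
  simp only [piPow, Matrix.mul_apply, ← Finset.prod_mul_distrib]
  rw [Finset.prod_univ_sum]
  simp

lemma piPow_conjTranspose (A : Matrix m k ℂ) (n : ℕ) :
    piPow Aᴴ n = (piPow A n)ᴴ := by
  ext x y
  simp [piPow, Matrix.conjTranspose_apply]

lemma piPow_diagonal [DecidableEq m] (d : m → ℂ) (n : ℕ) :
    piPow (diagonal d) n = diagonal (fun x : Fin n → m => ∏ i, d (x i)) := by
  ext x y
  by_cases h : x = y
  · subst h; simp [piPow]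
  · obtain ⟨i, hi⟩ := Function.ne_iff.mp h
    rw [diagonal_apply_ne _ h]
    exact Finset.prod_eq_zero (Finset.mem_univ i) (diagonal_apply_ne _ hi)

lemma piPow_one [DecidableEq m] (n : ℕ) : piPow (1 : Matrix m m ℂ) n = 1 := by
  rw [← diagonal_one, piPow_diagonal]; simp

lemma piPow_trace [Fintype m] (A : Matrix m m ℂ) (n : ℕ) :
    (piPow A n).trace = A.trace ^ n := by
  simp only [Matrix.trace, ← sum_prod_comp]
  rfl

lemma piPow_conj_diagonal [Fintype m] [DecidableEq m] (U : Matrix m m ℂ) (d : m → ℝ)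
    (n : ℕ) : piPow (U * diagonal (fun i => (d i : ℂ)) * Uᴴ) n =
      piPow U n * diagonal (fun x : Fin n → m => ((∏ i, d (x i) : ℝ) : ℂ)) * (piPow U n)ᴴ := by
  simp only [piPow_mul, piPow_diagonal, piPow_conjTranspose, Complex.ofReal_prod]

lemma piPow_mul_conjTranspose_eq_one [Fintype m] [DecidableEq m] {U : Matrix m m ℂ}
    (hU : U * Uᴴ = 1) (n : ℕ) : piPow U n * (piPow U n)ᴴ = 1 := by
  rw [← piPow_conjTranspose, ← piPow_mul, hU, piPow_one]

end piPow

section Spectral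

variable {m : Type*} [Fintype m]

lemma posSemidef_conj_diagonal {k : Type*} [Fintype k] [DecidableEq k] (U : Matrix m k ℂ)
    {d : k → ℝ} (hd : ∀ i, 0 ≤ d i) :
    (U * diagonal (fun i => (d i : ℂ)) * Uᴴ).PosSemidef := by
  refine PosSemidef.mul_mul_conjTranspose_same ?_ U
  exact posSemidef_diagonal_iff.2 fun i => by exact_mod_cast hd i

lemma conjTranspose_mul_self_diag_re (A : Matrix m m ℂ) (j : m) :
    ((Aᴴ * A) j j).re = ∑ i, ‖A i j‖ ^ 2 := by
  rw [Matrix.mul_apply, Complex.re_sum]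
  refine Finset.sum_congr rfl fun i _ => ?_
  rw [conjTranspose_apply, ← Complex.normSq_eq_norm_sq]
  simp [Complex.normSq_apply]

lemma mul_conjTranspose_self_diag_re (A : Matrix m m ℂ) (i : m) :
    ((A * Aᴴ) i i).re = ∑ j, ‖A i j‖ ^ 2 := by
  simpa using conjTranspose_mul_self_diag_re Aᴴ i

variable [DecidableEq m]

lemma Matrix.PosSemidef.exists_diagonalization {A : Matrix m m ℂ} (hA : A.PosSemidef) :
    ∃ (U : Matrix m m ℂ) (d : m → ℝ), U * Uᴴ = 1 ∧ Uᴴ * U = 1 ∧ (∀ i, 0 ≤ d i) ∧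
      A = U * diagonal (fun i => (d i : ℂ)) * Uᴴ ∧
      hermLog2 A = U * diagonal (fun i => (Real.logb 2 (d i) : ℂ)) * Uᴴ := by
  refine ⟨hA.1.eigenvectorUnitary, hA.1.eigenvalues,
    Unitary.coe_mul_star_self hA.1.eigenvectorUnitary,
    Unitary.coe_star_mul_self hA.1.eigenvectorUnitary, hA.eigenvalues_nonneg, ?_, ?_⟩
  · exact hA.1.spectral_theorem
  · rw [hermLog2, dif_pos hA.1]; rfl

lemma trace_mul_conj_diagonal (F U : Matrix m m ℂ) (d : m → ℝ) :
    (F * (U * diagonal (fun i => (d i : ℂ)) * Uᴴ)).trace.re =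
      ∑ i, d i * ((Uᴴ * F * U) i i).re := by
  rw [← Matrix.mul_assoc, ← Matrix.mul_assoc, Matrix.trace_mul_comm, ← Matrix.mul_assoc,
    ← Matrix.mul_assoc]
  simp [Matrix.trace, Matrix.mul_diagonal, mul_comm]

lemma Matrix.PosSemidef.trace_mul_re_nonneg {A B : Matrix m m ℂ} (hA : A.PosSemidef)
    (hB : B.PosSemidef) : 0 ≤ (A * B).trace.re := by
  obtain ⟨U, d, -, -, hd, rfl, -⟩ := hB.exists_diagonalization
  rw [trace_mul_conj_diagonal]
  refine Finset.sum_nonneg fun i _ => mul_nonneg (hd i) ?_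
  exact (Complex.le_def.1 (hA.conjTranspose_mul_mul_same U).diag_nonneg).1

lemma sub_mul_self_posSemidef {F : Matrix m m ℂ} (hF : F.PosSemidef) (hF1 : (1 - F).PosSemidef) :
    (F - F * F).PosSemidef := by
  have h1 := hF1.conjTranspose_mul_mul_same F
  have h2 := hF.conjTranspose_mul_mul_same (1 - F)
  rw [hF.1.eq] at h1
  rw [hF1.1.eq] at h2
  convert h1.add h2 using 1
  noncomm_ring

/-- A diagonal entry of an effect dominates the weight of the corresponding row of its image. -/
lemma sum_norm_sq_le_effect_diag {F U V : Matrix m m ℂ} (hU : U * Uᴴ = 1)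
    (hF : F.PosSemidef) (hF1 : (1 - F).PosSemidef) (j : m) :
    ∑ i, ‖(Uᴴ * F * V) i j‖ ^ 2 ≤ ((Vᴴ * F * V) j j).re := by
  rw [← conjTranspose_mul_self_diag_re]
  have h := ((sub_mul_self_posSemidef hF hF1).conjTranspose_mul_mul_same V).diag_nonneg (i := j)
  have e : (Uᴴ * F * V)ᴴ * (Uᴴ * F * V) = Vᴴ * (F * F) * V := by
    simp only [conjTranspose_mul, conjTranspose_conjTranspose, hF.1.eq]
    calc Vᴴ * (F * U) * (Uᴴ * F * V) = Vᴴ * F * (U * Uᴴ) * F * V := by noncomm_ring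
      _ = _ := by rw [hU]; noncomm_ring
  rw [e]
  have h' := (Complex.le_def.1 h).1
  rw [Matrix.mul_sub, Matrix.sub_mul, Matrix.sub_apply, Complex.sub_re] at h'
  simpa using h'

/-- Nussbaum–Szkoła lower bound on the errors of a quantum hypothesis test. -/
lemma nussbaum_szkola {F U V : Matrix m m ℂ} {p q : m → ℝ} (hU : U * Uᴴ = 1) (hV : V * Vᴴ = 1)
    (hp : ∀ i, 0 ≤ p i) (hq : ∀ i, 0 ≤ q i) (hF : F.PosSemidef) (hF1 : (1 - F).PosSemidef)
    {c : ℝ} (hc : 0 ≤ c) :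
    (1 / 2) * ∑ i, ∑ j, min (c * p i) (q j) * ‖(Uᴴ * V) i j‖ ^ 2 ≤
      (F * (V * diagonal (fun i => (q i : ℂ)) * Vᴴ)).trace.re +
        c * ((1 - F) * (U * diagonal (fun i => (p i : ℂ)) * Uᴴ)).trace.re := by
  have h1 : ∑ i, ∑ j, q j * ‖(Uᴴ * F * V) i j‖ ^ 2 ≤
      (F * (V * diagonal (fun i => (q i : ℂ)) * Vᴴ)).trace.re := by
    rw [trace_mul_conj_diagonal, Finset.sum_comm]
    refine Finset.sum_le_sum fun j _ => ?_
    rw [← Finset.mul_sum]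
    exact mul_le_mul_of_nonneg_left (sum_norm_sq_le_effect_diag hU hF hF1 j) (hq j)
  have h2 : ∑ i, ∑ j, c * p i * ‖(Uᴴ * (1 - F) * V) i j‖ ^ 2 ≤
      c * ((1 - F) * (U * diagonal (fun i => (p i : ℂ)) * Uᴴ)).trace.re := by
    rw [trace_mul_conj_diagonal, Finset.mul_sum]
    refine Finset.sum_le_sum fun i _ => ?_
    rw [← Finset.mul_sum, ← mul_assoc]
    refine mul_le_mul_of_nonneg_left ?_ (mul_nonneg hc (hp i))
    refine le_trans (le_of_eq ?_)
      (sum_norm_sq_le_effect_diag (V := U) hV hF1 (by simpa using hF) i)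
    refine Finset.sum_congr rfl fun j _ => ?_
    have : Vᴴ * (1 - F) * U = (Uᴴ * (1 - F) * V)ᴴ := by
      rw [conjTranspose_mul, conjTranspose_mul, hF1.1.eq, conjTranspose_conjTranspose,
        Matrix.mul_assoc]
    rw [this, conjTranspose_apply, norm_star]
  refine le_trans ?_ (add_le_add h1 h2)
  simp only [Finset.mul_sum, ← Finset.sum_add_distrib]
  refine Finset.sum_le_sum fun i _ => Finset.sum_le_sum fun j _ => ?_
  have e : (Uᴴ * V) i j = (Uᴴ * F * V) i j + (Uᴴ * (1 - F) * V) i j := by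
    rw [← Matrix.add_apply, ← Matrix.add_mul, ← Matrix.mul_add, add_sub_cancel, Matrix.mul_one]
  have hn : ‖(Uᴴ * V) i j‖ ≤ ‖(Uᴴ * F * V) i j‖ + ‖(Uᴴ * (1 - F) * V) i j‖ := by
    rw [e]; exact norm_add_le _ _
  set x := ‖(Uᴴ * F * V) i j‖
  set y := ‖(Uᴴ * (1 - F) * V) i j‖
  have hw : ‖(Uᴴ * V) i j‖ ^ 2 ≤ 2 * (x ^ 2 + y ^ 2) :=
    (pow_le_pow_left₀ (norm_nonneg _) hn 2).trans (by nlinarith [sq_nonneg (x - y)])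
  have hm : 0 ≤ min (c * p i) (q j) := le_min (mul_nonneg hc (hp i)) (hq j)
  nlinarith [mul_le_mul_of_nonneg_left hw hm,
    mul_le_mul_of_nonneg_right (min_le_left (c * p i) (q j)) (sq_nonneg y),
    mul_le_mul_of_nonneg_right (min_le_right (c * p i) (q j)) (sq_nonneg x)]

end Spectral

section Classical

lemma exists_pos_sum_mul_exp_lt_one {T : Type*} [Fintype T] {P d : T → ℝ}
    (hP : ∑ x, P x = 1) (hd : ∑ x, P x * d x < 0) :
    ∃ t : ℝ, 0 < t ∧ ∑ x, P x * Real.exp (t * d x) < 1 := by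
  have hderiv : HasDerivAt (fun t : ℝ => ∑ x, P x * Real.exp (t * d x)) (∑ x, P x * d x) 0 := by
    refine HasDerivAt.fun_sum fun x _ => ?_
    have := (((hasDerivAt_id (0 : ℝ)).mul_const (d x)).exp).const_mul (P x)
    simpa using this
  have hs := (hasDerivAt_iff_tendsto_slope_zero.1 hderiv).eventually (gt_mem_nhds hd)
  have hs' : ∀ᶠ t in nhdsWithin (0 : ℝ) (Set.Ioi 0),
      t⁻¹ • ((∑ x, P x * Real.exp ((0 + t) * d x)) - ∑ x, P x * Real.exp (0 * d x)) < 0 :=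
    hs.filter_mono (nhdsWithin_mono _ fun t ht => ne_of_gt ht)
  obtain ⟨t, ht, ht0⟩ := (hs'.and self_mem_nhdsWithin).exists
  refine ⟨t, ht0, ?_⟩
  simp only [zero_add, zero_mul, Real.exp_zero, mul_one, hP, smul_eq_mul] at ht
  have := (mul_neg_iff.1 ht).resolve_right fun h => absurd (inv_pos.2 ht0) (not_lt.2 h.1.le)
  linarith [this.2]

variable {T : Type*} {p q : T → ℝ} {w : T → T → ℝ}

lemma le_min_mul_prod (hp : ∀ i, 0 ≤ p i) (hq : ∀ i, 0 ≤ q i) (hw : ∀ i j, 0 ≤ w i j)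
    (hsupp : ∀ i j, q j = 0 → p i * w i j = 0) (s : ℝ) {t : ℝ} (ht : 0 < t) {n : ℕ}
    (x y : Fin n → T) :
    ((2 : ℝ) ^ (-s)) ^ n * (∏ i, p (x i) * w (x i) (y i) - ∏ i, p (x i) * w (x i) (y i) *
        Real.exp (t * (Real.logb 2 (p (x i)) - Real.logb 2 (q (y i)) - s))) ≤
      min (((2 : ℝ) ^ (-s)) ^ n * ∏ i, p (x i)) (∏ i, q (y i)) * ∏ i, w (x i) (y i) := by
  have hc : (0 : ℝ) ≤ ((2 : ℝ) ^ (-s)) ^ n := by positivity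
  have hW : 0 ≤ ∏ i, w (x i) (y i) := Finset.prod_nonneg fun i _ => hw _ _
  have hmin : 0 ≤ min (((2 : ℝ) ^ (-s)) ^ n * ∏ i, p (x i)) (∏ i, q (y i)) :=
    le_min (mul_nonneg hc (Finset.prod_nonneg fun i _ => hp _)) (Finset.prod_nonneg fun i _ => hq _)
  have hPn : 0 ≤ ∏ i, p (x i) * w (x i) (y i) :=
    Finset.prod_nonneg fun i _ => mul_nonneg (hp _) (hw _ _)
  rw [Finset.prod_mul_distrib (f := fun i => p (x i) * w (x i) (y i)), ← Real.exp_sum,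
    ← Finset.mul_sum]
  by_cases h : ∏ i, p (x i) * w (x i) (y i) = 0
  · rw [h]
    simpa using mul_nonneg hmin hW
  have hne : ∀ i, p (x i) * w (x i) (y i) ≠ 0 := fun i =>
    Finset.prod_ne_zero_iff.1 h i (Finset.mem_univ i)
  have hpi : ∀ i, 0 < p (x i) := fun i => (hp _).lt_of_ne' (left_ne_zero_of_mul (hne i))
  have hqi : ∀ i, 0 < q (y i) := fun i => (hq _).lt_of_ne' fun h0 => hne i (hsupp _ _ h0)
  rcases le_total (∑ i, (Real.logb 2 (p (x i)) - Real.logb 2 (q (y i)) - s)) 0 with hd | hd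
  · have hle : ((2 : ℝ) ^ (-s)) ^ n * ∏ i, p (x i) ≤ ∏ i, q (y i) := by
      have e : ((2 : ℝ) ^ (-s)) ^ n * ∏ i, p (x i) = (∏ i, q (y i)) *
          (2 : ℝ) ^ ∑ i, (Real.logb 2 (p (x i)) - Real.logb 2 (q (y i)) - s) := by
        rw [Real.rpow_sum_of_pos two_pos, ← Finset.prod_mul_distrib]
        have : ((2 : ℝ) ^ (-s)) ^ n = ∏ _i : Fin n, (2 : ℝ) ^ (-s) := by simp
        rw [this, ← Finset.prod_mul_distrib]
        refine Finset.prod_congr rfl fun i _ => ?_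
        rw [sub_eq_add_neg _ s, Real.rpow_add two_pos, Real.rpow_sub two_pos,
          Real.rpow_logb two_pos (by norm_num) (hpi i),
          Real.rpow_logb two_pos (by norm_num) (hqi i)]
        field_simp [(hqi i).ne']
      rw [e]
      exact mul_le_of_le_one_right (Finset.prod_nonneg fun i _ => hq _)
        (Real.rpow_le_one_of_one_le_of_nonpos one_le_two hd)
    rw [min_eq_left hle, mul_assoc, ← Finset.prod_mul_distrib]
    refine mul_le_mul_of_nonneg_left ?_ hc
    exact sub_le_self _ (mul_nonneg hPn (Real.exp_pos _).le)
  · refine le_trans (mul_nonpos_of_nonneg_of_nonpos hc (sub_nonpos.2 ?_)) (mul_nonneg hmin hW)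
    exact le_mul_of_one_le_right hPn (Real.one_le_exp (mul_nonneg ht.le hd))

lemma sum_mul_log_ratio_nonneg [Fintype T] (hp : ∀ i, 0 ≤ p i) (hq : ∀ i, 0 ≤ q i)
    (hw : ∀ i j, 0 ≤ w i j) (hP : ∑ i, ∑ j, p i * w i j = 1) (hQ : ∑ i, ∑ j, q j * w i j = 1)
    (hsupp : ∀ i j, q j = 0 → p i * w i j = 0) :
    0 ≤ ∑ i, ∑ j, p i * w i j * (Real.logb 2 (p i) - Real.logb 2 (q j)) := by
  have h2 : 0 < Real.log 2 := Real.log_pos one_lt_two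
  have key : ∀ i j, p i * w i j - q j * w i j ≤
      Real.log 2 * (p i * w i j * (Real.logb 2 (p i) - Real.logb 2 (q j))) := by
    intro i j
    by_cases h : p i * w i j = 0
    · rw [h]
      nlinarith [mul_nonneg (hq j) (hw i j)]
    · have hpi : 0 < p i := (hp i).lt_of_ne' (left_ne_zero_of_mul h)
      have hqj : 0 < q j := (hq j).lt_of_ne' fun h0 => h (hsupp i j h0)
      have hl := Real.log_le_sub_one_of_pos (div_pos hqj hpi)
      rw [Real.log_div hqj.ne' hpi.ne'] at hl
      have e : Real.log 2 * (p i * w i j * (Real.logb 2 (p i) - Real.logb 2 (q j))) =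
          p i * w i j * (Real.log (p i) - Real.log (q j)) := by
        simp only [Real.logb]; field_simp
      have e' : p i * w i j - q j * w i j = p i * w i j * (1 - q j / p i) := by
        field_simp
      rw [e, e']
      exact mul_le_mul_of_nonneg_left (by linarith) (mul_nonneg (hp i) (hw i j))
  have hs := Finset.sum_le_sum fun i (_ : i ∈ Finset.univ) =>
    Finset.sum_le_sum fun j (_ : j ∈ Finset.univ) => key i j
  simp only [Finset.sum_sub_distrib, ← Finset.mul_sum] at hs
  simp only [Finset.mul_sum] at hs hP hQ
  rw [hP, hQ] at hs
  simp only [← Finset.mul_sum, sub_self] at hs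
  exact nonneg_of_mul_nonneg_right hs h2

end Classical

section PartialTranspose

variable {ι κ : Type*}

lemma tpow_eq_submatrix (ρ : Matrix (ι × κ) (ι × κ) ℂ) (n : ℕ) :
    tpow ρ n = (piPow ρ n).submatrix
      (Equiv.arrowProdEquivProdArrow (Fin n) (fun _ => ι) (fun _ => κ)).symm
      (Equiv.arrowProdEquivProdArrow (Fin n) (fun _ => ι) (fun _ => κ)).symm := rfl

lemma ptrans_tpow (ρ : Matrix (ι × κ) (ι × κ) ℂ) (n : ℕ) :
    ptrans (tpow ρ n) = tpow (ptrans ρ) n := rfl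

variable [Fintype ι] [Fintype κ]

lemma trace_ptrans (A : Matrix (ι × κ) (ι × κ) ℂ) : (ptrans A).trace = A.trace := rfl

lemma trace_ptrans_mul_ptrans (A B : Matrix (ι × κ) (ι × κ) ℂ) :
    (ptrans A * ptrans B).trace = (A * B).trace := by
  simp only [Matrix.trace, Matrix.diag_apply, Matrix.mul_apply, Fintype.sum_prod_type, ptrans]
  refine Finset.sum_congr rfl fun i _ => ?_
  rw [Finset.sum_comm]
  conv_rhs => rw [Finset.sum_comm]
  refine Finset.sum_congr rfl fun k _ => ?_
  rw [Finset.sum_comm]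

lemma trace_submatrix_equiv {m k : Type*} [Fintype m] [Fintype k] (A : Matrix m m ℂ) (e : k ≃ m) :
    (A.submatrix e e).trace = A.trace :=
  Equiv.sum_comp e fun i => A i i

lemma tpow_trace (ρ : Matrix (ι × κ) (ι × κ) ℂ) (n : ℕ) : (tpow ρ n).trace = ρ.trace ^ n := by
  rw [tpow_eq_submatrix, trace_submatrix_equiv, piPow_trace]

variable [DecidableEq ι] [DecidableEq κ]

lemma tpow_posSemidef {ρ : Matrix (ι × κ) (ι × κ) ℂ} (hρ : ρ.PosSemidef) (n : ℕ) :
    (tpow ρ n).PosSemidef := by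
  obtain ⟨U, d, -, -, hd, rfl, -⟩ := hρ.exists_diagonalization
  rw [tpow_eq_submatrix, piPow_conj_diagonal]
  exact (posSemidef_conj_diagonal _ fun x => Finset.prod_nonneg fun i _ => hd _).submatrix _

lemma trace_mul_le_of_ptrans_le {F σ : Matrix (ι × κ) (ι × κ) ℂ} {K : ℝ}
    (hF : (((1 / K : ℝ) : ℂ) • 1 - ptrans F).PosSemidef) (hσ : (ptrans σ).PosSemidef)
    (hσtr : σ.trace = 1) : (F * σ).trace.re ≤ 1 / K := by
  have h := hF.trace_mul_re_nonneg hσ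
  rw [Matrix.sub_mul, Matrix.trace_sub, trace_ptrans_mul_ptrans, Matrix.smul_mul, Matrix.one_mul,
    Matrix.trace_smul, trace_ptrans, hσtr, Complex.sub_re] at h
  simp only [smul_eq_mul, mul_one, Complex.ofReal_re] at h
  linarith

end PartialTranspose

section Overlap

variable {m : Type*} [Fintype m] [DecidableEq m] {U V : Matrix m m ℂ} {p q : m → ℝ}

lemma sum_eigenvalues_eq_one (hU : Uᴴ * U = 1)
    (h : (U * diagonal (fun i => (p i : ℂ)) * Uᴴ).trace = 1) : ∑ i, p i = 1 := by
  have := trace_mul_conj_diagonal 1 U p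
  rw [Matrix.one_mul, h] at this
  simpa [hU] using this.symm

lemma sum_overlap_row (hU : Uᴴ * U = 1) (hV : V * Vᴴ = 1) (i : m) :
    ∑ j, ‖(Uᴴ * V) i j‖ ^ 2 = 1 := by
  rw [← mul_conjTranspose_self_diag_re]
  have : Uᴴ * V * (Uᴴ * V)ᴴ = 1 := by
    rw [conjTranspose_mul, conjTranspose_conjTranspose, Matrix.mul_assoc, ← Matrix.mul_assoc V, hV,
      Matrix.one_mul, hU]
  rw [this, one_apply_eq, Complex.one_re]

lemma sum_overlap_col (hU : U * Uᴴ = 1) (hV : Vᴴ * V = 1) (j : m) :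
    ∑ i, ‖(Uᴴ * V) i j‖ ^ 2 = 1 := by
  rw [← sum_overlap_row hV hU j]
  refine Finset.sum_congr rfl fun i _ => ?_
  rw [← norm_star, ← conjTranspose_apply, conjTranspose_mul, conjTranspose_conjTranspose]

lemma overlap_eq_zero_of_support (hU : Uᴴ * U = 1) (hV : Vᴴ * V = 1)
    (hsupp : ∀ v : m → ℂ, (V * diagonal (fun i => (q i : ℂ)) * Vᴴ) *ᵥ v = 0 →
      (U * diagonal (fun i => (p i : ℂ)) * Uᴴ) *ᵥ v = 0) (i j : m) (hj : q j = 0) :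
    p i * ‖(Uᴴ * V) i j‖ ^ 2 = 0 := by
  have h := hsupp (V.col j) <| by
    ext k
    change (V * diagonal (fun i => (q i : ℂ)) * Vᴴ * V) k j = 0
    rw [Matrix.mul_assoc, hV, Matrix.mul_one, Matrix.mul_diagonal, hj]
    simp
  have h' : (Uᴴ * (U * diagonal (fun i => (p i : ℂ)) * Uᴴ * V)) i j = 0 := by
    rw [Matrix.mul_apply]
    refine Finset.sum_eq_zero fun k _ => ?_
    rw [show (U * diagonal (fun i => (p i : ℂ)) * Uᴴ * V) k j = 0 from congrFun h k, mul_zero]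
  have e : Uᴴ * (U * diagonal (fun i => (p i : ℂ)) * Uᴴ * V) =
      diagonal (fun i => (p i : ℂ)) * (Uᴴ * V) := by
    simp only [← Matrix.mul_assoc, hU, Matrix.one_mul]
  rw [e, Matrix.diagonal_mul] at h'
  rcases mul_eq_zero.1 h' with h0 | h0
  · simp [Complex.ofReal_eq_zero.1 h0]
  · simp [h0]

lemma relEnt_eq_sum_overlap (hU : Uᴴ * U = 1) (hV : V * Vᴴ = 1) {ρ σ : Matrix m m ℂ}
    (hρ : ρ = U * diagonal (fun i => (p i : ℂ)) * Uᴴ)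
    (hρlog : hermLog2 ρ = U * diagonal (fun i => (Real.logb 2 (p i) : ℂ)) * Uᴴ)
    (hσlog : hermLog2 σ = V * diagonal (fun i => (Real.logb 2 (q i) : ℂ)) * Vᴴ) :
    relEnt ρ σ = ∑ i, ∑ j, p i * ‖(Uᴴ * V) i j‖ ^ 2 *
      (Real.logb 2 (p i) - Real.logb 2 (q j)) := by
  rw [relEnt, hρlog, hσlog, hρ, Matrix.trace_mul_comm, trace_mul_conj_diagonal]
  refine Finset.sum_congr rfl fun i _ => ?_
  have e1 : Uᴴ * (U * diagonal (fun i => (Real.logb 2 (p i) : ℂ)) * Uᴴ) * U =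
      diagonal (fun i => (Real.logb 2 (p i) : ℂ)) := by
    simp only [← Matrix.mul_assoc, hU, Matrix.one_mul]
    rw [Matrix.mul_assoc, hU, Matrix.mul_one]
  have e2 : Uᴴ * (V * diagonal (fun i => (Real.logb 2 (q i) : ℂ)) * Vᴴ) * U =
      Uᴴ * V * diagonal (fun i => (Real.logb 2 (q i) : ℂ)) * (Uᴴ * V)ᴴ := by
    simp only [conjTranspose_mul, conjTranspose_conjTranspose, Matrix.mul_assoc]
  have e3 : ((Uᴴ * V * diagonal (fun i => (Real.logb 2 (q i) : ℂ)) * (Uᴴ * V)ᴴ) i i).re =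
      ∑ j, ‖(Uᴴ * V) i j‖ ^ 2 * Real.logb 2 (q j) := by
    rw [Matrix.mul_apply, Complex.re_sum]
    refine Finset.sum_congr rfl fun j _ => ?_
    rw [Matrix.mul_diagonal, conjTranspose_apply, ← Complex.normSq_eq_norm_sq]
    simp [Complex.normSq_apply]
    ring
  rw [Matrix.mul_sub, Matrix.sub_mul, Matrix.sub_apply, e1, e2, Complex.sub_re, e3,
    diagonal_apply_eq, Complex.ofReal_re]
  simp only [mul_assoc, ← Finset.mul_sum, mul_sub, Finset.sum_sub_distrib, ← Finset.sum_mul,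
    sum_overlap_row hU hV i, one_mul]

end Overlap

/-- Trade-off between the two errors of a test distinguishing tensor powers of two states. -/
lemma tpow_test_tradeoff {ι κ : Type*} [Fintype ι] [Fintype κ] [DecidableEq ι] [DecidableEq κ]
    {U V : Matrix (ι × κ) (ι × κ) ℂ} {p q : ι × κ → ℝ} (hU : U * Uᴴ = 1) (hU' : Uᴴ * U = 1)
    (hV : V * Vᴴ = 1) (hp : ∀ i, 0 ≤ p i) (hq : ∀ i, 0 ≤ q i) (hp1 : ∑ i, p i = 1)
    (hsupp : ∀ i j, q j = 0 → p i * ‖(Uᴴ * V) i j‖ ^ 2 = 0) (s : ℝ) {t : ℝ} (ht : 0 < t) (n : ℕ)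
    {F : Matrix ((Fin n → ι) × (Fin n → κ)) ((Fin n → ι) × (Fin n → κ)) ℂ}
    (hF : F.PosSemidef) (hF1 : (1 - F).PosSemidef) :
    (1 / 2) * (((2 : ℝ) ^ (-s)) ^ n * (1 - (∑ i, ∑ j, p i * ‖(Uᴴ * V) i j‖ ^ 2 *
        Real.exp (t * (Real.logb 2 (p i) - Real.logb 2 (q j) - s))) ^ n)) ≤
      (F * tpow (V * diagonal (fun i => (q i : ℂ)) * Vᴴ) n).trace.re + ((2 : ℝ) ^ (-s)) ^ n *
        ((1 - F) * tpow (U * diagonal (fun i => (p i : ℂ)) * Uᴴ) n).trace.re := by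
  set e := Equiv.arrowProdEquivProdArrow (Fin n) (fun _ => ι) (fun _ => κ)
  have htr : ∀ (G : Matrix ((Fin n → ι) × (Fin n → κ)) ((Fin n → ι) × (Fin n → κ)) ℂ)
      (A : Matrix (ι × κ) (ι × κ) ℂ),
      (G * tpow A n).trace = (G.submatrix e e * piPow A n).trace := by
    intro G A
    rw [tpow_eq_submatrix, ← trace_submatrix_equiv _ e, ← Matrix.submatrix_mul_equiv _ _ e e e,
      Matrix.submatrix_submatrix, Equiv.symm_comp_self, Matrix.submatrix_id_id]
  have hsub : (1 - F).submatrix e e = 1 - F.submatrix e e := by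
    rw [Matrix.submatrix_sub, Pi.sub_apply, Pi.sub_apply, Matrix.submatrix_one_equiv]
  rw [htr, htr, hsub, piPow_conj_diagonal, piPow_conj_diagonal]
  refine le_trans ?_ (nussbaum_szkola (piPow_mul_conjTranspose_eq_one hU n)
    (piPow_mul_conjTranspose_eq_one hV n) (fun x => Finset.prod_nonneg fun i _ => hp _)
    (fun x => Finset.prod_nonneg fun i _ => hq _) (hF.submatrix e)
    (by rw [← hsub]; exact hF1.submatrix e) (by positivity))
  refine mul_le_mul_of_nonneg_left ?_ (by norm_num)
  have hone : ∑ i, ∑ j, p i * ‖(Uᴴ * V) i j‖ ^ 2 = 1 := by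
    simp only [← Finset.mul_sum, sum_overlap_row hU' hV, mul_one, hp1]
  rw [← one_pow (M := ℝ) n, ← hone, ← sum_sum_prod_comp,
    ← sum_sum_prod_comp, ← Finset.sum_sub_distrib, Finset.mul_sum]
  refine Finset.sum_le_sum fun x _ => ?_
  rw [← Finset.sum_sub_distrib, Finset.mul_sum]
  refine Finset.sum_le_sum fun y _ => ?_
  refine (le_min_mul_prod (w := fun i j => ‖(Uᴴ * V) i j‖ ^ 2) hp hq (fun _ _ => sq_nonneg _)
    hsupp s ht x y).trans (le_of_eq ?_)
  rw [← piPow_conjTranspose, ← piPow_mul]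
  simp only [piPow, norm_prod, Finset.prod_pow]

lemma exists_test_of_lt_FGamma {ι κ : Type*} [Fintype ι] [Fintype κ] [DecidableEq ι]
    [DecidableEq κ] {ρ : Matrix (ι × κ) (ι × κ) ℂ} {K x : ℝ} (hK : 0 ≤ K) (h : x < FGamma ρ K) :
    ∃ F : Matrix (ι × κ) (ι × κ) ℂ, F.PosSemidef ∧ (1 - F).PosSemidef ∧
      (((1 / K : ℝ) : ℂ) • 1 - ptrans F).PosSemidef ∧ x < (F * ρ).trace.re := by
  obtain ⟨y, ⟨F, h0, h1, h2, -, rfl⟩, hy⟩ := exists_lt_of_lt_csSup (by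
    have hpos : (((1 / K : ℝ) : ℂ) • (1 : Matrix (ι × κ) (ι × κ) ℂ)).PosSemidef :=
      PosSemidef.one.smul (by exact_mod_cast one_div_nonneg.2 hK)
    have h0 : ptrans (0 : Matrix (ι × κ) (ι × κ) ℂ) = 0 := rfl
    exact ⟨_, 0, .zero, by simpa using PosSemidef.one, by simpa [h0] using hpos,
      by simpa [h0] using hpos, rfl⟩) h
  exact ⟨F, h0, h1, h2, hy⟩

lemma one_div_floor_two_rpow_le {x : ℝ} (hx : 0 ≤ x) :
    1 / ((⌊(2 : ℝ) ^ x⌋ : ℤ) : ℝ) ≤ 2 * (2 : ℝ) ^ (-x) := by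
  have h1 : (1 : ℝ) ≤ 2 ^ x := Real.one_le_rpow one_le_two hx
  have h2 : (1 : ℝ) ≤ (⌊(2 : ℝ) ^ x⌋ : ℤ) := by exact_mod_cast Int.le_floor.2 (by simpa using h1)
  have h3 := Int.lt_floor_add_one ((2 : ℝ) ^ x)
  rw [Real.rpow_neg two_pos.le, ← div_eq_mul_inv, div_le_div_iff₀ (by linarith) (by linarith)]
  linarith

/-- Relative entropy bound: `D_Γ(ρ) ≤ S(ρ‖σ)` for any p.p.t. state `σ`
whose support contains the support of `ρ`. -/
theorem DGamma_le_relEnt_ppt {a b : ℕ}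
    (ρ σ : Matrix (Fin a × Fin b) (Fin a × Fin b) ℂ)
    (hρ : ρ.PosSemidef) (hρtr : ρ.trace = 1)
    (hσ : σ.PosSemidef) (hσtr : σ.trace = 1)
    (hσppt : (ptrans σ).PosSemidef)
    (hsupp : ∀ v : (Fin a × Fin b) → ℂ, σ *ᵥ v = 0 → ρ *ᵥ v = 0) :
    DGamma ρ ≤ relEnt ρ σ := by
  obtain ⟨U, p, hU, hU', hp, hρe, hρlog⟩ := hρ.exists_diagonalization
  obtain ⟨V, q, hV, hV', hq, hσe, hσlog⟩ := hσ.exists_diagonalization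
  have hp1 : ∑ i, p i = 1 := sum_eigenvalues_eq_one hU' (hρe ▸ hρtr)
  have hq1 : ∑ i, q i = 1 := sum_eigenvalues_eq_one hV' (hσe ▸ hσtr)
  have hzero := overlap_eq_zero_of_support (p := p) (q := q) hU' hV' (by rwa [← hσe, ← hρe])
  have hent := relEnt_eq_sum_overlap hU' hV hρe hρlog hσlog
  have hP : ∑ i, ∑ j, p i * ‖(Uᴴ * V) i j‖ ^ 2 = 1 := by
    simp only [← Finset.mul_sum, sum_overlap_row hU' hV, mul_one, hp1]
  have hQ : ∑ i, ∑ j, q j * ‖(Uᴴ * V) i j‖ ^ 2 = 1 := by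
    rw [Finset.sum_comm]
    simp only [← Finset.mul_sum, sum_overlap_col hU hV', mul_one, hq1]
  refine Real.sSup_le ?_ (hent ▸
    sum_mul_log_ratio_nonneg hp hq (fun _ _ => sq_nonneg _) hP hQ hzero)
  rintro r ⟨hr0, hr⟩
  by_contra! hlt
  obtain ⟨s, hs, hsr⟩ := exists_between hlt
  obtain ⟨t, ht, hθ⟩ := exists_pos_sum_mul_exp_lt_one
    (P := fun x : (Fin a × Fin b) × (Fin a × Fin b) => p x.1 * ‖(Uᴴ * V) x.1 x.2‖ ^ 2)
    (d := fun x => Real.logb 2 (p x.1) - Real.logb 2 (q x.2) - s)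
    (by rw [Fintype.sum_prod_type, hP]) (by
      rw [Fintype.sum_prod_type]
      simp only [mul_sub _ _ s, Finset.sum_sub_distrib, ← Finset.sum_mul]
      rw [hP, ← hent]
      linarith)
  rw [Fintype.sum_prod_type] at hθ
  dsimp only at hθ
  set θ := ∑ i, ∑ j, p i * ‖(Uᴴ * V) i j‖ ^ 2 *
    Real.exp (t * (Real.logb 2 (p i) - Real.logb 2 (q j) - s))
  have hθ0 : 0 ≤ θ := Finset.sum_nonneg fun i _ => Finset.sum_nonneg fun j _ =>
    mul_nonneg (mul_nonneg (hp i) (sq_nonneg _)) (Real.exp_pos _).le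
  have hγ : (2 : ℝ) ^ (s - r) < 1 := Real.rpow_lt_one_of_one_lt_of_neg one_lt_two (by linarith)
  have hγ0 : (0 : ℝ) ≤ (2 : ℝ) ^ (s - r) := by positivity
  obtain ⟨n, ⟨hn1, hn2⟩, hn3⟩ :=
    ((((tendsto_pow_atTop_nhds_zero_of_lt_one hθ0 hθ).eventually
      (gt_mem_nhds (show (0 : ℝ) < 1 / 4 by norm_num))).and
    ((tendsto_pow_atTop_nhds_zero_of_lt_one hγ0 hγ).eventually
      (gt_mem_nhds (show (0 : ℝ) < 1 / 32 by norm_num)))).and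
    (hr.eventually (lt_mem_nhds (show (3 / 4 : ℝ) < 1 by norm_num)))).exists
  have hrn : 0 ≤ r * (n : ℝ) := mul_nonneg hr0 n.cast_nonneg
  obtain ⟨F, hF, hF1, hFΓ, hFρ⟩ := exists_test_of_lt_FGamma
    (by exact_mod_cast Int.floor_nonneg.2 (Real.rpow_nonneg two_pos.le _)) hn3
  have htest := tpow_test_tradeoff hU hU' hV hp hq hp1 hzero s ht n hF hF1
  rw [← hρe, ← hσe, Matrix.sub_mul, Matrix.one_mul, Matrix.trace_sub, tpow_trace, hρtr, one_pow,
    Complex.sub_re, Complex.one_re] at htest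
  have hFσ := (trace_mul_le_of_ptrans_le (σ := tpow σ n) hFΓ
    (by rw [ptrans_tpow]; exact tpow_posSemidef hσppt n)
    (by rw [tpow_trace, hσtr, one_pow])).trans (one_div_floor_two_rpow_le hrn)
  have hsplit : (2 : ℝ) ^ (-(r * n)) = ((2 : ℝ) ^ (-s)) ^ n * ((2 : ℝ) ^ (s - r)) ^ n := by
    rw [← mul_pow, ← Real.rpow_add two_pos, ← Real.rpow_mul_natCast two_pos.le]
    congr 1
    ring
  rw [hsplit] at hFσ
  have hc : (0 : ℝ) < ((2 : ℝ) ^ (-s)) ^ n := by positivity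
  nlinarith [mul_lt_mul_of_pos_left hn1 hc, mul_lt_mul_of_pos_left hn2 hc,
    mul_lt_mul_of_pos_left hFρ hc]
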